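/- arXiv:2604.15511 — 3 statements merged into one kernel-verified Lean document; each statement's English description precedes it below -/
import Mathlib

section
/- Assume the setup. Let (τ, (e_q), (k_q), (ℓ_q)) be a tuple satisfying condition (*) (with N = r), and let Γ be its associated metric tree, with projection coordinates d^q_α computed in Γ. Then for every q ∈ {1,…,r}: (1) d^q_{k_q} + k_q·B^(n−3−q) = d^q_{ℓ_q} + ℓ_q·B^(n−3−q), i.e. the k_q and ℓ_q terms of the minimum in (H_q) agree, and the sum of λ(e) over e ∈ P_q equals (ℓ_q − k_q)·B^(n−3−q); (2) for every α ∈ S_q ∖ {i_q, j_q, k_q, ℓ_q} such that d^q_α + α·B^(n−3−q) ≥ d^q_{k_q} + k_q·B^(n−3−q), one in fact has d^q_α + α·B^(n−3−q) ≥ d^q_{k_q} + k_q·B^(n−3−q) + (1/2)·B^(n−3−q). (Paper: Proposition that the metric tree of a (*)-tuple satisfies the path equations and the (1/2)·B^(n−3−q) gap, Section 6.) -/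
open scoped Classical

namespace TropPsi

/-- A finite tree with vertices marked by `Fin n` (the `n` legs). -/
structure MTree (n : ℕ) where
  V : Type
  [fintypeV : Fintype V]
  [decEqV : DecidableEq V]
  G : SimpleGraph V
  isTree : G.IsTree
  mark : Fin n → V

attribute [instance] MTree.fintypeV MTree.decEqV

namespace MTree

variable {n : ℕ}

/-- The unique path between two vertices of a tree, as a walk. -/
noncomputable def path (τ : MTree n) (u v : τ.V) : τ.G.Walk u v :=
  (τ.isTree.existsUnique_path u v).exists.choose

/-- An edge lies on the path between `u` and `v`. -/
def onPath (τ : MTree n) (u v : τ.V) (e : Sym2 τ.V) : Prop :=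
  e ∈ (τ.path u v).edges

/-- The set of edges lying both on the path between legs `i` and `j` and on the
path between legs `k` and `l`. -/
def PathSet (τ : MTree n) (i j k l : Fin n) : Set (Sym2 τ.V) :=
  {e | τ.onPath (τ.mark i) (τ.mark j) e ∧ τ.onPath (τ.mark k) (τ.mark l) e}

/-- Stability: at every vertex, degree plus number of legs is at least `3`. -/
def Stable (τ : MTree n) : Prop :=
  ∀ v : τ.V, 3 ≤ {w : τ.V | τ.G.Adj v w}.ncard + {α : Fin n | τ.mark α = v}.ncard

end MTree

/-- A stable `[n]`-marked metric tree: a marked tree together with a length function. -/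
structure MMTree (n : ℕ) extends MTree n where
  len : Sym2 V → ℝ

/-- Equip a marked tree with a length function. -/
def MTree.withLen {n : ℕ} (τ : MTree n) (lam : Sym2 τ.V → ℝ) : MMTree n :=
  { toMTree := τ, len := lam }

namespace MMTree

variable {n : ℕ}

/-- All edges have positive length. -/
def PosLen (Γ : MMTree n) : Prop :=
  ∀ e ∈ Γ.G.edgeSet, 0 < Γ.len e

/-- The distance `d(α,β)` between the legs `α` and `β`. -/
noncomputable def legDist (Γ : MMTree n) (α β : Fin n) : ℝ :=
  ((Γ.toMTree.path (Γ.mark α) (Γ.mark β)).edges.map Γ.len).sum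

/-- The projection coordinate `d_l^{(i,j)}`. -/
noncomputable def proj (Γ : MMTree n) (i j l : Fin n) : ℝ :=
  (Γ.legDist i l + Γ.legDist i j - Γ.legDist j l) / 2

/-- The quantity `d_α^{(i,j)} + α · c` being minimized in condition `(H_q)`;
the leg `α : Fin n` has numerical value `α + 1 ∈ {1, …, n}`. -/
noncomputable def hval (Γ : MMTree n) (i j : Fin n) (c : ℝ) (α : Fin n) : ℝ :=
  Γ.proj i j α + (((α : ℕ) : ℝ) + 1) * c

/-- `α` attains the minimum of `d^{(i,j)} + (·) · c` over `S \ {i, j}`. -/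
def Minimizes (Γ : MMTree n) (S : Finset (Fin n)) (i j : Fin n) (c : ℝ) (α : Fin n) : Prop :=
  α ∈ S \ {i, j} ∧ ∀ γ ∈ S \ {i, j}, Γ.hval i j c α ≤ Γ.hval i j c γ

/-- Condition `(H)`: the minimum is attained at least twice. -/
def CondH (Γ : MMTree n) (S : Finset (Fin n)) (i j : Fin n) (c : ℝ) : Prop :=
  ∃ α β : Fin n, α ≠ β ∧ Γ.Minimizes S i j c α ∧ Γ.Minimizes S i j c β

end MMTree


/-- Condition `(*)` for a tuple `(τ, (e_q), (k_q), (l_q))` (stages `q = 1, …, N`,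
with stage data `S, i, j`): `τ` has exactly `N` edges enumerated by `e`, and for
each stage `q` the elements `k_q < l_q` lie in `S_q ∖ {i_q, j_q}`, the paths from
leg `i_q` to leg `l_q` and from leg `k_q` to leg `j_q` are vertex-disjoint, and the
set `P_q` of common edges of the `(i_q,j_q)`- and `(k_q,l_q)`-paths contains `e_q`
but no `e_{q'}` with `q' < q`. -/
def CondStar (n : ℕ) (S : ℕ → Finset (Fin n)) (i j : ℕ → Fin n)
    (τ : MTree n) (N : ℕ) (e : ℕ → Sym2 τ.V) (k l : ℕ → Fin n) : Prop :=
  τ.G.edgeSet.ncard = N ∧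
  (∀ q, 1 ≤ q → q ≤ N → e q ∈ τ.G.edgeSet) ∧
  (∀ q q', 1 ≤ q → q < q' → q' ≤ N → e q ≠ e q') ∧
  ∀ q, 1 ≤ q → q ≤ N →
    k q ∈ S q \ {i q, j q} ∧ l q ∈ S q \ {i q, j q} ∧ k q < l q ∧
    (∀ w : τ.V, w ∈ (τ.path (τ.mark (i q)) (τ.mark (l q))).support →
      w ∉ (τ.path (τ.mark (k q)) (τ.mark (j q))).support) ∧
    e q ∈ τ.PathSet (i q) (j q) (k q) (l q) ∧
    ∀ q', 1 ≤ q' → q' < q → e q' ∉ τ.PathSet (i q) (j q) (k q) (l q)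

/-- `y` is the edge-length vector of the tuple `(τ, (e_q), (k_q), (l_q))`:
it satisfies the downward recursion
`y_q = (l_q − k_q)·B^(n−3−q) − Σ_{q' > q, e_{q'} ∈ P_q} y_{q'}`. -/
def IsEdgeLenVec (n : ℕ) (B : ℝ) (τ : MTree n) (N : ℕ) (e : ℕ → Sym2 τ.V)
    (i j k l : ℕ → Fin n) (y : ℕ → ℝ) : Prop :=
  ∀ q, 1 ≤ q → q ≤ N →
    y q = (((l q : ℕ) : ℝ) - ((k q : ℕ) : ℝ)) * B ^ (n - 3 - q) -
      ∑ q' ∈ (Finset.Icc (q + 1) N).filter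
        (fun q' => e q' ∈ τ.PathSet (i q) (j q) (k q) (l q)), y q'

namespace MTree

variable {n : ℕ} (τ : MTree n)

lemma path_isPath (u v : τ.V) : (τ.path u v).IsPath :=
  (τ.isTree.existsUnique_path u v).exists.choose_spec

variable {τ}

lemma not_onPath_iff {u v : τ.V} {e : Sym2 τ.V} :
    ¬ τ.onPath u v e ↔ ∃ p : τ.G.Walk u v, e ∉ p.edges := by
  refine ⟨fun h => ⟨_, h⟩, ?_⟩
  rintro ⟨p, hp⟩ h
  have h' : τ.path u v = p.bypass :=
    (τ.isTree.existsUnique_path u v).unique (τ.path_isPath u v) p.bypass_isPath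
  rw [onPath, h'] at h
  exact hp (p.edges_bypass_subset_edges h)

lemma onPath_comm {u v : τ.V} {e : Sym2 τ.V} : τ.onPath u v e ↔ τ.onPath v u e := by
  rw [← not_iff_not, not_onPath_iff, not_onPath_iff]
  constructor <;> exact fun ⟨p, hp⟩ => ⟨p.reverse, by simpa using hp⟩

lemma not_onPath_trans {u v w : τ.V} {e : Sym2 τ.V} (h : ¬ τ.onPath u v e)
    (h' : ¬ τ.onPath v w e) : ¬ τ.onPath u w e := by
  rw [not_onPath_iff] at *
  obtain ⟨p, hp⟩ := h
  obtain ⟨q, hq⟩ := h'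
  exact ⟨p.append q, by simp [hp, hq]⟩

/-- Every vertex is on the side of one of the two endpoints of an edge. -/
lemma not_onPath_left_or_right (a b v : τ.V) :
    ¬ τ.onPath v a s(a, b) ∨ ¬ τ.onPath v b s(a, b) := by
  obtain ⟨p⟩ := τ.isTree.connected.preconnected v a
  have key : ∀ {x y : τ.V} (_ : τ.G.Walk x y), y = a →
      ¬ τ.onPath x a s(a, b) ∨ ¬ τ.onPath x b s(a, b) := by
    intro x y p
    induction p with
    | nil =>
      rintro rfl
      exact Or.inl (not_onPath_iff.2 ⟨.nil, by simp⟩)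
    | @cons x z y h p ih =>
      intro hy
      by_cases hxz : s(x, z) = s(a, b)
      · rcases Sym2.eq_iff.1 hxz with ⟨rfl, -⟩ | ⟨rfl, -⟩
        · exact Or.inl (not_onPath_iff.2 ⟨.nil, by simp⟩)
        · exact Or.inr (not_onPath_iff.2 ⟨.nil, by simp⟩)
      · have hx : ¬ τ.onPath x z s(a, b) :=
          not_onPath_iff.2 ⟨.cons h .nil, by simpa using Ne.symm hxz⟩
        exact (ih hy).imp (not_onPath_trans hx) (not_onPath_trans hx)
  exact key p rfl

/-- Removing an edge leaves only two components. -/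
lemma not_onPath_of_onPath_of_onPath {u v w : τ.V} {e : Sym2 τ.V} (h : τ.onPath u v e)
    (h' : τ.onPath v w e) : ¬ τ.onPath u w e := by
  induction e with
  | h a b =>
    have tr : ∀ {x y z : τ.V}, ¬ τ.onPath x z s(a, b) → ¬ τ.onPath y z s(a, b) →
        ¬ τ.onPath x y s(a, b) :=
      fun hx hy => not_onPath_trans hx (mt onPath_comm.1 hy)
    rcases not_onPath_left_or_right a b u with hu | hu <;>
    rcases not_onPath_left_or_right a b v with hv | hv <;>
    rcases not_onPath_left_or_right a b w with hw | hw <;>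
    first
      | exact tr hu hw
      | exact absurd h (tr hu hv)
      | exact absurd h' (tr hv hw)

lemma onPath_iff_xor (v : τ.V) {u w : τ.V} {e : Sym2 τ.V} :
    τ.onPath u w e ↔ ¬ (τ.onPath u v e ↔ τ.onPath v w e) := by
  have h₁ := @not_onPath_of_onPath_of_onPath n τ u v w e
  have h₂ := @not_onPath_trans n τ u v w e
  have h₃ := @not_onPath_trans n τ v u w e
  have h₄ := @not_onPath_trans n τ u w v e
  rw [onPath_comm (u := v) (v := u)] at h₃
  rw [onPath_comm (u := w) (v := v)] at h₄
  tauto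

lemma not_onPath_of_mem_support {u v w : τ.V} {f : Sym2 τ.V} (hw : w ∈ (τ.path u v).support)
    (hf : ¬ τ.onPath u v f) : ¬ τ.onPath u w f :=
  not_onPath_iff.2 ⟨(τ.path u v).takeUntil w hw,
    fun h => hf ((τ.path u v).edges_takeUntil_subset_edges hw h)⟩

/-- Two paths that share an edge but avoid the edge `f` lie on the same side of `f`. -/
lemma not_onPath_of_common_edge {i a b j : τ.V} {e f : Sym2 τ.V}
    (he : τ.onPath i a e) (he' : τ.onPath b j e) (hf : ¬ τ.onPath i a f)
    (hf' : ¬ τ.onPath b j f) : ¬ τ.onPath i b f := by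
  induction e with
  | h x y =>
    have h₁ := not_onPath_of_mem_support ((τ.path i a).fst_mem_support_of_mem_edges he) hf
    have h₂ := not_onPath_of_mem_support ((τ.path b j).fst_mem_support_of_mem_edges he') hf'
    exact not_onPath_trans h₁ (mt onPath_comm.1 h₂)

/-- The initial segments cut out on the path from `i` to `j` by the projections of `a` and `b`
are nested. -/
lemma onPath_nested (i j a b : τ.V) :
    (∀ e, τ.onPath i j e → τ.onPath i a e → τ.onPath i b e) ∨
      ∀ e, τ.onPath i j e → τ.onPath i b e → τ.onPath i a e := by
  by_contra! h
  obtain ⟨⟨e, hej, hea, heb⟩, f, hfj, hfb, hfa⟩ := h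
  refine not_onPath_of_common_edge (i := i) (a := a) (b := b) (j := j) hea ?_ hfa ?_ hfb
  · have := (onPath_iff_xor b).1 hej
    tauto
  · have := (onPath_iff_xor b).1 hfj
    tauto

lemma not_onPath_of_disjoint {u v w x : τ.V}
    (h : ∀ z ∈ (τ.path u v).support, z ∉ (τ.path w x).support) {e : Sym2 τ.V}
    (he : τ.onPath u v e) : ¬ τ.onPath w x e := by
  intro he'
  induction e with
  | h a b =>
    exact h a ((τ.path u v).fst_mem_support_of_mem_edges he)
      ((τ.path w x).fst_mem_support_of_mem_edges he')

lemma image_Icc_eq_edgeSet {N : ℕ} {e : ℕ → Sym2 τ.V} (hcard : τ.G.edgeSet.ncard = N)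
    (hmem : ∀ q, 1 ≤ q → q ≤ N → e q ∈ τ.G.edgeSet)
    (hinj : Set.InjOn e (Finset.Icc 1 N)) :
    (Finset.Icc 1 N).image e = τ.G.edgeSet.toFinset := by
  apply Finset.eq_of_subset_of_card_le
  · intro x hx
    obtain ⟨q, hq, rfl⟩ := Finset.mem_image.1 hx
    rw [Finset.mem_Icc] at hq
    simpa using hmem q hq.1 hq.2
  · rw [Finset.card_image_of_injOn hinj, ← Set.ncard_eq_toFinset_card', hcard]
    simp

lemma sum_edges_path {N : ℕ} {e : ℕ → Sym2 τ.V}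
    (himage : (Finset.Icc 1 N).image e = τ.G.edgeSet.toFinset)
    (hinj : Set.InjOn e (Finset.Icc 1 N)) (lam : Sym2 τ.V → ℝ) (u v : τ.V) :
    ((τ.path u v).edges.map lam).sum =
      ∑ q ∈ Finset.Icc 1 N, if τ.onPath u v (e q) then lam (e q) else 0 := by
  rw [← List.sum_toFinset _ (τ.path_isPath u v).isTrail.edges_nodup,
    ← Finset.sum_image (f := fun x => if τ.onPath u v x then lam x else 0) hinj, himage,
    ← Finset.sum_filter]
  refine Finset.sum_congr ?_ fun _ _ => rfl
  ext x
  rw [List.mem_toFinset, Finset.mem_filter, Set.mem_toFinset]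
  exact ⟨fun h => ⟨(τ.path u v).edges_subset_edgeSet h, h⟩, fun h => h.2⟩

/-- The projection coordinate is the length of the common part of the paths from `i`
to `j` and from `i` to `a`. -/
lemma proj_withLen {N : ℕ} {e : ℕ → Sym2 τ.V}
    (himage : (Finset.Icc 1 N).image e = τ.G.edgeSet.toFinset)
    (hinj : Set.InjOn e (Finset.Icc 1 N)) (lam : Sym2 τ.V → ℝ) (i j a : Fin n) :
    (τ.withLen lam).proj i j a = ∑ q ∈ (Finset.Icc 1 N).filter (fun q =>
      τ.onPath (τ.mark i) (τ.mark j) (e q) ∧ τ.onPath (τ.mark i) (τ.mark a) (e q)),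
        lam (e q) := by
  have hd : ∀ α β : Fin n, (τ.withLen lam).legDist α β = ∑ q ∈ Finset.Icc 1 N,
      if τ.onPath (τ.mark α) (τ.mark β) (e q) then lam (e q) else 0 := fun α β =>
    sum_edges_path himage hinj lam (τ.mark α) (τ.mark β)
  rw [MMTree.proj, hd, hd, hd, ← Finset.sum_add_distrib, ← Finset.sum_sub_distrib,
    Finset.sum_div, Finset.sum_filter]
  refine Finset.sum_congr rfl fun q _ => ?_
  have h := onPath_iff_xor (τ.mark i) (u := τ.mark j) (w := τ.mark a) (e := e q)
  rw [onPath_comm (u := τ.mark j) (v := τ.mark i)] at h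
  by_cases h₁ : τ.onPath (τ.mark i) (τ.mark j) (e q) <;>
  by_cases h₂ : τ.onPath (τ.mark i) (τ.mark a) (e q) <;>
  simp [h, h₁, h₂]

end MTree

/-- A downward recursion with coefficients in `[1, n]` has solutions of the order of `B ^ (m - q)`. -/
lemma bounds_of_recursion {n r m : ℕ} (hrm : r ≤ m) {B : ℝ} (hB : 2 * (n : ℝ) + 1 ≤ B)
    {w y : ℕ → ℝ} {P : ℕ → ℕ → Prop}
    (hw : ∀ q, 1 ≤ q → q ≤ r → 1 ≤ w q ∧ w q ≤ n)
    (hy : ∀ q, 1 ≤ q → q ≤ r → y q = w q * B ^ (m - q) -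
      ∑ q' ∈ (Finset.Icc (q + 1) r).filter (P q), y q')
    {q : ℕ} (hq : q ≤ r) :
    (∀ q', q < q' → q' ≤ r → B ^ (m - q') / 2 ≤ y q') ∧
      ∑ q' ∈ Finset.Icc (q + 1) r, y q' ≤ B ^ (m - q) / 2 := by
  have hB0 : 0 < B := by linarith [(Nat.cast_nonneg n : (0 : ℝ) ≤ n)]
  induction hq using Nat.decreasingInduction with
  | self =>
    refine ⟨fun q' h h' => absurd h (not_lt.2 h'), ?_⟩
    simp only [Finset.Icc_eq_empty_of_lt (Nat.lt_succ_self r), Finset.sum_empty]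
    positivity
  | of_succ q hq ih =>
    obtain ⟨ih₁, ih₂⟩ := ih
    have hnn : ∀ q' ∈ Finset.Icc (q + 1 + 1) r, 0 ≤ y q' := fun q' h => by
      rw [Finset.mem_Icc] at h
      have := ih₁ q' (by omega) h.2
      have : 0 < B ^ (m - q') := by positivity
      linarith
    have hs₀ : 0 ≤ ∑ q' ∈ (Finset.Icc (q + 1 + 1) r).filter (P (q + 1)), y q' :=
      Finset.sum_nonneg fun q' h => hnn q' (Finset.mem_filter.1 h).1
    have hs₁ : ∑ q' ∈ (Finset.Icc (q + 1 + 1) r).filter (P (q + 1)), y q' ≤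
        ∑ q' ∈ Finset.Icc (q + 1 + 1) r, y q' :=
      Finset.sum_le_sum_of_subset_of_nonneg (Finset.filter_subset _ _) fun q' h _ => hnn q' h
    have hyq := hy (q + 1) (by omega) hq
    obtain ⟨hw₁, hw₂⟩ := hw (q + 1) (by omega) hq
    have hc : 0 < B ^ (m - (q + 1)) := by positivity
    have hpow : B ^ (m - q) = B * B ^ (m - (q + 1)) := by
      rw [← pow_succ']
      congr 1
      omega
    refine ⟨fun q' h h' => ?_, ?_⟩
    · rcases (Nat.succ_le_of_lt h).eq_or_lt with rfl | h
      · simp only [Nat.succ_eq_add_one]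
        nlinarith
      · exact ih₁ q' h h'
    · rw [← Finset.add_sum_Ioc_eq_sum_Icc hq, ← Finset.Icc_add_one_left_eq_Ioc, hpow]
      nlinarith

/-- A sum of edge lengths that omits index `q` is either negligible or dominant compared with
`n * B ^ (m - q)`. -/
lemma sum_small_or_large {n r m q : ℕ} (hrm : r ≤ m) (hqr : q ≤ r) {B : ℝ}
    (hB : 2 * (n : ℝ) + 1 ≤ B) {y : ℕ → ℝ}
    (hy : ∀ q', 1 ≤ q' → q' ≤ r → B ^ (m - q') / 2 ≤ y q')
    (hs : ∑ q' ∈ Finset.Icc (q + 1) r, y q' ≤ B ^ (m - q) / 2)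
    {X : Finset ℕ} (hX : X ⊆ Finset.Icc 1 r) (hqX : q ∉ X) :
    0 ≤ ∑ q' ∈ X, y q' ∧ (∑ q' ∈ X, y q' ≤ B ^ (m - q) / 2 ∨
      ((n : ℝ) + 1 / 2) * B ^ (m - q) ≤ ∑ q' ∈ X, y q') := by
  have hB1 : 1 ≤ B := by linarith [(Nat.cast_nonneg n : (0 : ℝ) ≤ n)]
  have hnn : ∀ q' ∈ Finset.Icc 1 r, 0 ≤ y q' := fun q' h => by
    rw [Finset.mem_Icc] at h
    have := hy q' h.1 h.2
    have : 0 < B ^ (m - q') := by positivity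
    linarith
  refine ⟨Finset.sum_nonneg fun q' h => hnn q' (hX h), ?_⟩
  by_cases h : ∃ q' ∈ X, q' < q
  · obtain ⟨q', hq', hlt⟩ := h
    right
    obtain ⟨h₁, h₂⟩ := Finset.mem_Icc.1 (hX hq')
    have hle : y q' ≤ ∑ q' ∈ X, y q' :=
      Finset.single_le_sum (fun x hx => hnn x (hX hx)) hq'
    have hpow : B * B ^ (m - q) ≤ B ^ (m - q') := by
      rw [← pow_succ']
      exact pow_le_pow_right₀ hB1 (by omega)
    have := hy q' h₁ h₂
    have hc : 0 < B ^ (m - q) := by positivity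
    nlinarith
  · left
    push Not at h
    refine le_trans (Finset.sum_le_sum_of_subset_of_nonneg (fun x hx => ?_) fun x hx _ => ?_) hs
    · have := h x hx
      have := Finset.mem_Icc.1 (hX hx)
      have : x ≠ q := fun h' => hqX (h' ▸ hx)
      rw [Finset.mem_Icc]
      omega
    · refine hnn x ?_
      rw [Finset.mem_Icc] at *
      omega

/-- A nonzero integer multiple `a - b` of `c`, perturbed by an amount that is small or large
compared with `c`, is at least `c / 2` once it is nonnegative. -/
lemma half_le_of_small_or_large {n : ℕ} {a b : Fin n} (hab : a ≠ b) {c s : ℝ} (hc : 0 < c)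
    (hs : |s| ≤ c / 2 ∨ ((n : ℝ) + 1 / 2) * c ≤ |s|)
    (h : 0 ≤ s + (((a : ℕ) : ℝ) - ((b : ℕ) : ℝ)) * c) :
    c / 2 ≤ s + (((a : ℕ) : ℝ) - ((b : ℕ) : ℝ)) * c := by
  have ha : ((a : ℕ) : ℝ) ≤ n := by exact_mod_cast a.2.le
  have hb : ((b : ℕ) : ℝ) ≤ n := by exact_mod_cast b.2.le
  have ha' : (0 : ℝ) ≤ ((a : ℕ) : ℝ) := Nat.cast_nonneg _
  have hb' : (0 : ℝ) ≤ ((b : ℕ) : ℝ) := Nat.cast_nonneg _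
  rcases hs with hs | hs
  · obtain ⟨h₁, h₂⟩ := abs_le.1 hs
    rcases lt_or_gt_of_ne hab with hlt | hlt
    · have : ((a : ℕ) : ℝ) + 1 ≤ ((b : ℕ) : ℝ) := by exact_mod_cast hlt
      nlinarith
    · have : ((b : ℕ) : ℝ) + 1 ≤ ((a : ℕ) : ℝ) := by exact_mod_cast hlt
      nlinarith
  · rcases le_abs'.1 hs with hs | hs <;> nlinarith

/-- Proposition that the metric tree of a `(*)`-tuple satisfies
the path equations and the `(1/2)·B^(n−3−q)` gap, Section 6. -/
theorem statement_6
    (n r : ℕ) (hn : 3 ≤ n) (hr1 : 1 ≤ r) (hrn : r ≤ n - 3)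
    (S : ℕ → Finset (Fin n)) (i j : ℕ → Fin n)
    (hScard : ∀ q, 1 ≤ q → q ≤ r → 3 ≤ (S q).card)
    (hiS : ∀ q, 1 ≤ q → q ≤ r → i q ∈ S q)
    (hjS : ∀ q, 1 ≤ q → q ≤ r → j q ∈ S q)
    (hij : ∀ q, 1 ≤ q → q ≤ r → i q ≠ j q)
    (B : ℝ) (hB : 2 * (n : ℝ) + 1 ≤ B)
    -- a tuple satisfying condition `(*)` (with `N = r`)
    (τ : MTree n) (hstab : τ.Stable)
    (e : ℕ → Sym2 τ.V) (k l : ℕ → Fin n)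
    (hstar : CondStar n S i j τ r e k l)
    -- its edge-length vector and associated metric tree
    (y : ℕ → ℝ) (hy : IsEdgeLenVec n B τ r e i j k l y)
    (lam : Sym2 τ.V → ℝ) (hlam : ∀ q, 1 ≤ q → q ≤ r → lam (e q) = y q) :
    ∀ q, 1 ≤ q → q ≤ r →
      -- (1) the `k_q` and `l_q` terms of the minimum in `(H_q)` agree …
      (τ.withLen lam).hval (i q) (j q) (B ^ (n - 3 - q)) (k q) =
        (τ.withLen lam).hval (i q) (j q) (B ^ (n - 3 - q)) (l q) ∧
      -- … and the total length of `P_q` equals `(l_q − k_q)·B^(n−3−q)`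
      (∑ q' ∈ (Finset.Icc 1 r).filter
          (fun q' => e q' ∈ τ.PathSet (i q) (j q) (k q) (l q)), lam (e q')) =
        (((l q : ℕ) : ℝ) - ((k q : ℕ) : ℝ)) * B ^ (n - 3 - q) ∧
      -- (2) any other index of `S_q` weakly above the common value exceeds it
      -- by at least `(1/2)·B^(n−3−q)`
      ∀ α ∈ S q, α ≠ i q → α ≠ j q → α ≠ k q → α ≠ l q →
        (τ.withLen lam).hval (i q) (j q) (B ^ (n - 3 - q)) (k q) ≤
          (τ.withLen lam).hval (i q) (j q) (B ^ (n - 3 - q)) α →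
        (τ.withLen lam).hval (i q) (j q) (B ^ (n - 3 - q)) (k q) +
            (1 / 2 : ℝ) * B ^ (n - 3 - q) ≤
          (τ.withLen lam).hval (i q) (j q) (B ^ (n - 3 - q)) α := by
  obtain ⟨hcard, hmem, hne, hst⟩ := hstar
  have hinj : Set.InjOn e (Finset.Icc 1 r) := by
    intro a ha b hb hab
    rw [Finset.mem_coe, Finset.mem_Icc] at ha hb
    rcases lt_trichotomy a b with h | h | h
    · exact absurd hab (hne a b ha.1 h hb.2)
    · exact h
    · exact absurd hab.symm (hne b a hb.1 h ha.2)
  have himage := MTree.image_Icc_eq_edgeSet hcard hmem hinj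
  have hB0 : 0 < B := by linarith [(Nat.cast_nonneg n : (0 : ℝ) ≤ n)]
  have hw : ∀ q, 1 ≤ q → q ≤ r →
      1 ≤ ((l q : ℕ) : ℝ) - ((k q : ℕ) : ℝ) ∧ ((l q : ℕ) : ℝ) - ((k q : ℕ) : ℝ) ≤ n := by
    intro q h₁ h₂
    have hkl : ((k q : ℕ) : ℝ) + 1 ≤ ((l q : ℕ) : ℝ) := by
      exact_mod_cast (hst q h₁ h₂).2.2.1
    have hln : ((l q : ℕ) : ℝ) ≤ n := by exact_mod_cast (l q).2.le
    have hk0 : (0 : ℝ) ≤ ((k q : ℕ) : ℝ) := Nat.cast_nonneg _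
    constructor <;> linarith
  have hbd := fun q hq => bounds_of_recursion (q := q) hrn hB hw hy hq
  intro q hq1 hqr
  obtain ⟨-, -, -, hdisj, heP, hlow⟩ := hst q hq1 hqr
  set c := B ^ (n - 3 - q) with hc
  have hc0 : 0 < c := by positivity
  let Q : Fin n → Finset ℕ := fun a => (Finset.Icc 1 r).filter fun q' =>
    τ.onPath (τ.mark (i q)) (τ.mark (j q)) (e q') ∧ τ.onPath (τ.mark (i q)) (τ.mark a) (e q')
  have hQ : ∀ a, Q a ⊆ Finset.Icc 1 r := fun a => Finset.filter_subset _ _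
  have hlamy : ∀ X ⊆ Finset.Icc 1 r, ∑ q' ∈ X, lam (e q') = ∑ q' ∈ X, y q' := fun X hX =>
    Finset.sum_congr rfl fun x hx => by
      obtain ⟨h₁, h₂⟩ := Finset.mem_Icc.1 (hX hx)
      exact hlam x h₁ h₂
  have hproj : ∀ a, (τ.withLen lam).hval (i q) (j q) c a =
      ∑ q' ∈ Q a, y q' + (((a : ℕ) : ℝ) + 1) * c := fun a => by
    rw [MMTree.hval, MTree.proj_withLen himage hinj, hlamy _ (hQ a)]
  have hgap : ∀ a b : Fin n, a ≠ b → (q ∈ Q a ↔ q ∈ Q b) →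
      (τ.withLen lam).hval (i q) (j q) c b ≤ (τ.withLen lam).hval (i q) (j q) c a →
      (τ.withLen lam).hval (i q) (j q) c b + 1 / 2 * c ≤
        (τ.withLen lam).hval (i q) (j q) c a := by
    intro a b hab hqab hle
    have hX := fun X (hX : X ⊆ Finset.Icc 1 r) (hqX : q ∉ X) => sum_small_or_large hrn hqr hB
      (fun q' h₁ h₂ => (hbd 0 (Nat.zero_le r)).1 q' h₁ h₂) (hbd q hqr).2 hX hqX
    have hs : |∑ q' ∈ Q a, y q' - ∑ q' ∈ Q b, y q'| ≤ c / 2 ∨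
        ((n : ℝ) + 1 / 2) * c ≤ |∑ q' ∈ Q a, y q' - ∑ q' ∈ Q b, y q'| := by
      rcases MTree.onPath_nested (τ.mark (i q)) (τ.mark (j q)) (τ.mark a) (τ.mark b)
        with hn | hn
      · have hsub : Q a ⊆ Q b := Finset.monotone_filter_right _ fun x _ h => ⟨h.1, hn _ h.1 h.2⟩
        obtain ⟨h₀, h⟩ := hX (Q b \ Q a) (Finset.sdiff_subset.trans (hQ b))
          (fun h => (Finset.mem_sdiff.1 h).2 (hqab.2 (Finset.mem_sdiff.1 h).1))
        rw [← Finset.sum_sdiff hsub, sub_add_cancel_right, abs_neg, abs_of_nonneg h₀]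
        exact h
      · have hsub : Q b ⊆ Q a := Finset.monotone_filter_right _ fun x _ h => ⟨h.1, hn _ h.1 h.2⟩
        obtain ⟨h₀, h⟩ := hX (Q a \ Q b) (Finset.sdiff_subset.trans (hQ a))
          (fun h => (Finset.mem_sdiff.1 h).2 (hqab.1 (Finset.mem_sdiff.1 h).1))
        rw [← Finset.sum_sdiff hsub, add_sub_cancel_right, abs_of_nonneg h₀]
        exact h
    rw [hproj, hproj] at hle ⊢
    have := half_le_of_small_or_large hab hc0 hs (by linarith)
    linarith
  have hPsum : ∑ q' ∈ (Finset.Icc 1 r).filter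
      (fun q' => e q' ∈ τ.PathSet (i q) (j q) (k q) (l q)), y q' =
        (((l q : ℕ) : ℝ) - ((k q : ℕ) : ℝ)) * c := by
    have hP : (Finset.Icc 1 r).filter (fun q' => e q' ∈ τ.PathSet (i q) (j q) (k q) (l q)) =
        insert q ((Finset.Icc (q + 1) r).filter
          (fun q' => e q' ∈ τ.PathSet (i q) (j q) (k q) (l q))) := by
      ext x
      simp only [Finset.mem_filter, Finset.mem_insert, Finset.mem_Icc]
      constructor
      · rintro ⟨⟨h₁, h₂⟩, h₃⟩
        rcases lt_trichotomy x q with h | h | h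
        · exact absurd h₃ (hlow x h₁ h)
        · exact Or.inl h
        · exact Or.inr ⟨⟨h, h₂⟩, h₃⟩
      · rintro (rfl | ⟨⟨h₁, h₂⟩, h₃⟩)
        · exact ⟨⟨hq1, hqr⟩, heP⟩
        · exact ⟨⟨by omega, h₂⟩, h₃⟩
    rw [hP, Finset.sum_insert (by simp), hy q hq1 hqr]
    ring
  have hmemP : ∀ ε, ε ∈ τ.PathSet (i q) (j q) (k q) (l q) ↔
      τ.onPath (τ.mark (i q)) (τ.mark (j q)) ε ∧ τ.onPath (τ.mark (i q)) (τ.mark (k q)) ε ∧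
        ¬ τ.onPath (τ.mark (i q)) (τ.mark (l q)) ε := by
    intro ε
    have h₁ := MTree.onPath_iff_xor (τ.mark (i q)) (u := τ.mark (k q)) (w := τ.mark (l q)) (e := ε)
    have h₂ := MTree.onPath_iff_xor (τ.mark (k q)) (u := τ.mark (i q)) (w := τ.mark (j q)) (e := ε)
    have h₃ := fun h => MTree.not_onPath_of_disjoint hdisj (e := ε) h
    rw [MTree.onPath_comm (u := τ.mark (k q)) (v := τ.mark (i q))] at h₁
    simp only [MTree.PathSet, Set.mem_ofPred_eq]
    tauto
  have hlk : ∀ ε, τ.onPath (τ.mark (i q)) (τ.mark (j q)) ε →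
      τ.onPath (τ.mark (i q)) (τ.mark (l q)) ε → τ.onPath (τ.mark (i q)) (τ.mark (k q)) ε := by
    intro ε h h'
    have h₂ := MTree.onPath_iff_xor (τ.mark (k q)) (u := τ.mark (i q)) (w := τ.mark (j q)) (e := ε)
    have h₃ := MTree.not_onPath_of_disjoint hdisj h'
    tauto
  have heq : (τ.withLen lam).hval (i q) (j q) c (k q) =
      (τ.withLen lam).hval (i q) (j q) c (l q) := by
    have hsub : Q (l q) ⊆ Q (k q) :=
      Finset.monotone_filter_right _ fun x _ h => ⟨h.1, hlk _ h.1 h.2⟩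
    have hdiff : Q (k q) \ Q (l q) = (Finset.Icc 1 r).filter
        (fun q' => e q' ∈ τ.PathSet (i q) (j q) (k q) (l q)) := by
      ext x
      simp only [Q, Finset.mem_sdiff, Finset.mem_filter, hmemP]
      tauto
    rw [hproj, hproj, ← Finset.sum_sdiff hsub, hdiff, hPsum]
    ring
  refine ⟨heq, ?_, fun α _ _ _ hαk hαl hle => ?_⟩
  · rw [hlamy _ (Finset.filter_subset _ _), hPsum]
  · have hqP := (hmemP _).1 heP
    have hqI : q ∈ Finset.Icc 1 r := Finset.mem_Icc.2 ⟨hq1, hqr⟩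
    have hqk : q ∈ Q (k q) := Finset.mem_filter.2 ⟨hqI, hqP.1, hqP.2.1⟩
    have hql : q ∉ Q (l q) := fun h => hqP.2.2 (Finset.mem_filter.1 h).2.2
    by_cases hqα : q ∈ Q α
    · exact hgap α (k q) hαk (by tauto) hle
    · rw [heq] at hle ⊢
      exact hgap α (l q) hαl (by tauto) hle

end TropPsi
end

section
/- Assume the setup. Let Γ = (T, m, λ) be a stable [n]-marked metric tree with at most r edges satisfying (H_q) for every q ∈ {1,…,r}. Let e_1, …, e_r be the edges of T listed in decreasing order of length, and for each q ∈ {1,…,r} let k_q < ℓ_q be the two elements of S_q ∖ {i_q, j_q} at which the minimum in (H_q) is attained. Then the tuple ((T, m), (e_q), (k_q), (ℓ_q)) satisfies condition (*); in particular, for every q the path in T between m(i_q) and m(ℓ_q) and the path between m(k_q) and m(j_q) have no common vertex. (Paper: Corollary that points of Σ_r ∩ ⋂_{q=1}^r Trop(H_q) give tuples satisfying condition (*), Section 6.) -/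
open scoped Classical

namespace TropPsi

namespace MTree

variable {n : ℕ} (τ : MTree n)

lemma eq_path {u v : τ.V} {p : τ.G.Walk u v} (hp : p.IsPath) : p = τ.path u v :=
  (τ.isTree.existsUnique_path u v).unique hp (τ.path_isPath u v)

lemma path_edges_comm (u v : τ.V) : (τ.path u v).edges = (τ.path v u).edges.reverse := by
  rw [← τ.eq_path (τ.path_isPath v u).reverse, SimpleGraph.Walk.edges_reverse]

lemma path_edges_of_mem_support {u v w : τ.V} (hw : w ∈ (τ.path u v).support) :
    (τ.path u v).edges = (τ.path u w).edges ++ (τ.path w v).edges := by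
  rw [← τ.eq_path ((τ.path_isPath u v).takeUntil hw),
    ← τ.eq_path ((τ.path_isPath u v).dropUntil hw), ← SimpleGraph.Walk.edges_append,
    SimpleGraph.Walk.take_spec]

lemma onPath_iff_not_reachable (u v : τ.V) (x : Sym2 τ.V) :
    τ.onPath u v x ↔ ¬ (τ.G.deleteEdges {x}).Reachable u v := by
  constructor
  · rintro hx ⟨p⟩
    have hle : τ.G.deleteEdges {x} ≤ τ.G := SimpleGraph.deleteEdges_le _
    have hq : (p.toPath.1.mapLe hle).IsPath := p.toPath.2.mapLe hle
    rw [onPath, ← τ.eq_path hq, SimpleGraph.Walk.edges_mapLe_eq_edges] at hx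
    have := p.toPath.1.edges_subset_edgeSet hx
    simp at this
  · intro h
    by_contra hx
    exact h ⟨(τ.path u v).toDeleteEdge x hx⟩

/-- An edge of a tree splits the vertices into two sides, and it lies on a path exactly when the
endpoints of the path are on different sides. -/
lemma exists_side {x : Sym2 τ.V} (hx : x ∈ τ.G.edgeSet) :
    ∃ s : τ.V → Prop, ∀ u v, τ.onPath u v x ↔ ¬ (s u ↔ s v) := by
  induction x with
  | _ a b =>
  have cover (v : τ.V) : (τ.G.deleteEdges {s(a, b)}).Reachable a v ∨
      (τ.G.deleteEdges {s(a, b)}).Reachable b v := by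
    obtain ⟨t, ht⟩ : ∃ t, t = a := ⟨a, rfl⟩
    obtain ⟨p⟩ := τ.isTree.1.preconnected v t
    induction p with
    | nil => exact Or.inl (ht ▸ .rfl)
    | @cons u w _ huw _ ih =>
      by_cases h : s(u, w) = s(a, b)
      · rcases Sym2.eq_iff.1 h with ⟨rfl, -⟩ | ⟨rfl, -⟩
        · exact Or.inl .rfl
        · exact Or.inr .rfl
      · have hwu : (τ.G.deleteEdges {s(a, b)}).Reachable w u :=
          (SimpleGraph.deleteEdges_adj.2 ⟨huw, h⟩).reachable.symm
        exact (ih ht).imp (·.trans hwu) (·.trans hwu)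
  refine ⟨fun v => (τ.G.deleteEdges {s(a, b)}).Reachable a v, fun u v => ?_⟩
  rw [onPath_iff_not_reachable, not_iff_not]
  refine ⟨fun h => ⟨(·.trans h), (·.trans h.symm)⟩, fun h => ?_⟩
  by_cases hu : (τ.G.deleteEdges {s(a, b)}).Reachable a u
  · exact hu.symm.trans (h.1 hu)
  · exact ((cover u).resolve_left hu).symm.trans ((cover v).resolve_left (mt h.2 hu))

/-- The common edges of two paths between marked vertices, as a finite set. -/
noncomputable def commonEdges (i j k l : Fin n) : Finset (Sym2 τ.V) :=
  τ.G.edgeFinset.filter (· ∈ τ.PathSet i j k l)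

lemma mem_commonEdges {i j k l : Fin n} {x : Sym2 τ.V} :
    x ∈ τ.commonEdges i j k l ↔ x ∈ τ.PathSet i j k l := by
  rw [commonEdges, Finset.mem_filter, SimpleGraph.mem_edgeFinset, and_iff_right_iff_imp]
  exact fun h => SimpleGraph.Walk.edges_subset_edgeSet _ h.1

end MTree

namespace MMTree

variable {n : ℕ} (Γ : MMTree n)

/-- The length of the path between two vertices. -/
noncomputable def vdist (u v : Γ.V) : ℝ :=
  ((Γ.toMTree.path u v).edges.map Γ.len).sum

lemma vdist_comm (u v : Γ.V) : Γ.vdist u v = Γ.vdist v u := by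
  rw [vdist, vdist, Γ.path_edges_comm, List.map_reverse, List.sum_reverse]

lemma vdist_of_mem_support {u v w : Γ.V} (hw : w ∈ (Γ.toMTree.path u v).support) :
    Γ.vdist u v = Γ.vdist u w + Γ.vdist w v := by
  rw [vdist, Γ.path_edges_of_mem_support hw, List.map_append, List.sum_append, vdist, vdist]

lemma vdist_eq_sum (u v : Γ.V) :
    Γ.vdist u v = ∑ x ∈ Γ.G.edgeFinset, if Γ.onPath u v x then Γ.len x else 0 := by
  rw [vdist, ← List.sum_toFinset _ (Γ.path_isPath u v).isTrail.edges_nodup, ← Finset.sum_filter]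
  refine Finset.sum_congr (Finset.ext fun x => ?_) fun _ _ => rfl
  rw [List.mem_toFinset, Finset.mem_filter, SimpleGraph.mem_edgeFinset]
  exact ⟨fun h => ⟨SimpleGraph.Walk.edges_subset_edgeSet _ h, h⟩, And.right⟩

variable {Γ}

lemma vdist_triangle (hpos : Γ.PosLen) (u v w : Γ.V) :
    Γ.vdist u w ≤ Γ.vdist u v + Γ.vdist v w := by
  simp only [vdist_eq_sum, ← Finset.sum_add_distrib]
  refine Finset.sum_le_sum fun x hx => ?_
  rw [SimpleGraph.mem_edgeFinset] at hx
  have h0 := hpos x hx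
  obtain ⟨s, hs⟩ := Γ.exists_side hx
  simp only [hs]
  by_cases hu : s u <;> by_cases hv : s v <;> by_cases hw : s w <;> simp [hu, hv, hw] <;> linarith

lemma disjoint_of_proj_lt (hpos : Γ.PosLen) {i j k l : Fin n} (h : Γ.proj i j l < Γ.proj i j k)
    {w : Γ.V} (hw : w ∈ (Γ.path (Γ.mark i) (Γ.mark l)).support) :
    w ∉ (Γ.path (Γ.mark k) (Γ.mark j)).support := by
  intro hw'
  have h1 := Γ.vdist_of_mem_support hw
  have h2 := Γ.vdist_of_mem_support hw'
  have h3 := vdist_triangle hpos (Γ.mark i) w (Γ.mark k)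
  have h4 := vdist_triangle hpos (Γ.mark j) w (Γ.mark l)
  rw [Γ.vdist_comm w (Γ.mark k)] at h3
  rw [Γ.vdist_comm (Γ.mark j) w] at h4
  rw [Γ.vdist_comm (Γ.mark k) (Γ.mark j)] at h2
  simp only [proj, legDist] at h
  simp only [vdist] at h1 h2 h3 h4
  linarith

lemma sum_commonEdges (hpos : Γ.PosLen) {i j k l : Fin n} (h : Γ.proj i j l < Γ.proj i j k) :
    ∑ x ∈ Γ.commonEdges i j k l, Γ.len x = Γ.proj i j k - Γ.proj i j l := by
  have hproj : Γ.proj i j k - Γ.proj i j l =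
      (Γ.vdist (Γ.mark i) (Γ.mark k) - Γ.vdist (Γ.mark j) (Γ.mark k)
        - Γ.vdist (Γ.mark i) (Γ.mark l) + Γ.vdist (Γ.mark j) (Γ.mark l)) / 2 := by
    simp only [proj, legDist, vdist]
    ring
  rw [hproj, MTree.commonEdges, Finset.sum_filter]
  simp only [vdist_eq_sum, ← Finset.sum_add_distrib, ← Finset.sum_sub_distrib, Finset.sum_div]
  refine Finset.sum_congr rfl fun x hx => ?_
  rw [SimpleGraph.mem_edgeFinset] at hx
  have hdisj : ¬ (Γ.onPath (Γ.mark i) (Γ.mark l) x ∧ Γ.onPath (Γ.mark k) (Γ.mark j) x) := by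
    rintro ⟨h1, h2⟩
    induction x with
    | _ a b =>
    exact disjoint_of_proj_lt hpos h (SimpleGraph.Walk.fst_mem_support_of_mem_edges _ h1)
      (SimpleGraph.Walk.fst_mem_support_of_mem_edges _ h2)
  obtain ⟨s, hs⟩ := Γ.exists_side hx
  simp only [MTree.PathSet, Set.mem_ofPred_eq, hs] at hdisj ⊢
  by_cases hi : s (Γ.mark i) <;> by_cases hj : s (Γ.mark j) <;> by_cases hk : s (Γ.mark k) <;>
    by_cases hl : s (Γ.mark l) <;> simp_all

lemma proj_sub_proj_of_minimizes {S : Finset (Fin n)} {i j k l : Fin n} {c : ℝ}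
    (hk : Γ.Minimizes S i j c k) (hl : Γ.Minimizes S i j c l) :
    Γ.proj i j k - Γ.proj i j l = (((l : ℕ) : ℝ) - ((k : ℕ) : ℝ)) * c := by
  have h := le_antisymm (hk.2 l hl.1) (hl.2 k hk.1)
  simp only [hval] at h
  linarith

end MMTree

lemma sum_biUnion_le_sum {ι E : Type*} {w : E → ℝ} (s : Finset ι) (P : ι → Finset E)
    (hw : ∀ q, ∀ x ∈ P q, 0 ≤ w x) :
    ∑ x ∈ s.biUnion P, w x ≤ ∑ q ∈ s, ∑ x ∈ P q, w x := by
  induction s using Finset.induction_on with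
  | empty => simp
  | insert a s ha ih =>
    rw [Finset.biUnion_insert, Finset.sum_insert ha]
    have h := Finset.sum_union_inter (s₁ := P a) (s₂ := s.biUnion P) (f := w)
    have h0 : 0 ≤ ∑ x ∈ P a ∩ s.biUnion P, w x :=
      Finset.sum_nonneg fun x hx => hw a x (Finset.mem_inter.1 hx).1
    linarith

/-- If each of the `|ι|` sets `P q` outweighs twice all later ones together, and there are at most
`|ι|` elements in total, then the elements in decreasing order of weight satisfy `e q ∈ P q` and
`e q ∉ P q'` for `q < q'`. -/
lemma mem_and_notMem_of_dominating {ι E : Type*} [Fintype ι] [LinearOrder ι] {U : Finset E}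
    (hU : U.card ≤ Fintype.card ι) {w : E → ℝ} (hw : ∀ x ∈ U, 0 < w x) {P : ι → Finset E}
    (hPU : ∀ q, P q ⊆ U)
    (hdom : ∀ q, 2 * ∑ q' with q < q', ∑ x ∈ P q', w x < ∑ x ∈ P q, w x)
    {e : ι → E} (heU : ∀ q, e q ∈ U) (hanti : StrictAnti (w ∘ e)) (q : ι) :
    e q ∈ P q ∧ ∀ q', q < q' → e q ∉ P q' := by
  have hw0 (q : ι) : ∀ x ∈ P q, 0 ≤ w x := fun x hx => (hw x (hPU q hx)).le
  have hbiUnion (q : ι) : ∑ x ∈ (Finset.univ.filter (q < ·)).biUnion P, w x ≤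
      ∑ q' with q < q', ∑ x ∈ P q', w x :=
    sum_biUnion_le_sum _ _ hw0
  have hex (q : ι) : ∃ x ∈ P q, ∀ q', q < q' → x ∉ P q' := by
    by_contra! hcon
    have hsub : P q ⊆ (Finset.univ.filter (q < ·)).biUnion P := fun x hx => by
      simpa using hcon x hx
    have h0 : ∀ x ∈ (Finset.univ.filter (q < ·)).biUnion P, 0 ≤ w x := fun x hx => by
      obtain ⟨q', -, hx⟩ := Finset.mem_biUnion.1 hx
      exact hw0 q' x hx
    have h1 := Finset.sum_le_sum_of_subset_of_nonneg hsub fun x hx _ => h0 x hx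
    have h2 := Finset.sum_nonneg h0
    linarith [hdom q, hbiUnion q]
  choose f hfP hf using hex
  have hsurj {g : ι → E} (hg : Function.Injective g) (hgU : ∀ q, g q ∈ U) :
      ∀ x, x ∈ U ↔ x ∈ Set.range g := by
    have himage : Finset.univ.image g = U :=
      Finset.eq_of_subset_of_card_le (Finset.image_subset_iff.2 fun q _ => hgU q)
        (by rwa [Finset.card_image_of_injective _ hg, Finset.card_univ])
    intro x
    simp [← himage]
  have hfinj : Function.Injective f := by
    intro a b hab
    by_contra hne
    rcases lt_or_gt_of_ne hne with h | h
    · exact hf a b h (hab ▸ hfP b)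
    · exact hf b a h (hab ▸ hfP a)
  have hfU := hsurj hfinj fun q => hPU q (hfP q)
  have hcover (q : ι) : P q ⊆ insert (f q) ((Finset.univ.filter (q < ·)).biUnion P) := by
    intro x hx
    obtain ⟨p, rfl⟩ := (hfU x).1 (hPU q hx)
    rcases lt_trichotomy p q with h | rfl | h
    · exact absurd hx (hf p q h)
    · exact Finset.mem_insert_self _ _
    · exact Finset.mem_insert_of_mem
        (Finset.mem_biUnion.2 ⟨p, Finset.mem_filter.2 ⟨Finset.mem_univ _, h⟩, hfP p⟩)
  have hfanti : StrictAnti (w ∘ f) := by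
    intro a b hab
    have h0 : ∀ x ∈ insert (f a) ((Finset.univ.filter (a < ·)).biUnion P), 0 ≤ w x := by
      intro x hx
      rcases Finset.mem_insert.1 hx with rfl | hx
      · exact hw0 a _ (hfP a)
      · obtain ⟨q', -, hx⟩ := Finset.mem_biUnion.1 hx
        exact hw0 q' x hx
    have h1 := Finset.sum_le_sum_of_subset_of_nonneg (hcover a) fun x hx _ => h0 x hx
    have hnot : f a ∉ (Finset.univ.filter (a < ·)).biUnion P := by
      simpa using hf a
    rw [Finset.sum_insert hnot] at h1
    have h2 : w (f b) ≤ ∑ x ∈ P b, w x := Finset.single_le_sum (hw0 b) (hfP b)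
    have h3 : ∑ x ∈ P b, w x ≤ ∑ q' with a < q', ∑ x ∈ P q', w x :=
      Finset.single_le_sum (f := fun q' => ∑ x ∈ P q', w x)
        (fun q' _ => Finset.sum_nonneg (hw0 q')) (by simpa using hab)
    simp only [Function.comp_apply]
    linarith [hdom a, hbiUnion a]
  have hcomp : w ∘ e = w ∘ f := by
    have hrange : Set.range e = Set.range f := by
      ext x
      rw [← hsurj (hanti.injective.of_comp) heU x, hfU x]
    refine (StrictMono.range_inj (γ := ℝᵒᵈ) (f := OrderDual.toDual ∘ w ∘ e)
      (g := OrderDual.toDual ∘ w ∘ f) hanti hfanti).1 ?_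
    rw [← Function.comp_assoc, ← Function.comp_assoc, Set.range_comp _ e, Set.range_comp _ f,
      hrange]
  obtain ⟨p, hp⟩ := (hfU _).1 (heU q)
  have hpq : p = q := hfanti.injective (by
    rw [← congrFun hcomp q, Function.comp_apply, Function.comp_apply, hp])
  subst hpq
  rw [← hp]
  exact ⟨hfP p, hf p⟩

lemma sum_Ioc_pow_sub_le {B a : ℝ} (hB : a + 1 ≤ B) (hB0 : 0 ≤ B) {N q r : ℕ} (hqr : q ≤ r)
    (hr : r ≤ N) : a * ∑ p ∈ Finset.Ioc q r, B ^ (N - p) ≤ B ^ (N - q) - B ^ (N - r) := by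
  induction r, hqr using Nat.le_induction with
  | base => simp
  | succ r hqr ih =>
    have h := ih (by omega)
    have hsucc : N - r = N - (r + 1) + 1 := by omega
    have h0 : 0 ≤ B ^ (N - (r + 1)) := pow_nonneg hB0 _
    rw [Finset.sum_Ioc_succ_top hqr, mul_add]
    rw [hsucc, pow_succ] at h
    nlinarith [mul_le_mul_of_nonneg_left hB h0]

/-- Corollary that points of `Σ_r ∩ ⋂ Trop(H_q)` give tuples
satisfying condition `(*)`, Section 6. -/
theorem statement_9
    (n r : ℕ) (hn : 3 ≤ n) (hr1 : 1 ≤ r) (hrn : r ≤ n - 3)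
    (S : ℕ → Finset (Fin n)) (i j : ℕ → Fin n)
    (hScard : ∀ q, 1 ≤ q → q ≤ r → 3 ≤ (S q).card)
    (hiS : ∀ q, 1 ≤ q → q ≤ r → i q ∈ S q)
    (hjS : ∀ q, 1 ≤ q → q ≤ r → j q ∈ S q)
    (hij : ∀ q, 1 ≤ q → q ≤ r → i q ≠ j q)
    (B : ℝ) (hB : 2 * (n : ℝ) + 1 ≤ B)
    (Γ : MMTree n) (hpos : Γ.PosLen) (hstab : Γ.toMTree.Stable)
    (hedge : Γ.G.edgeSet.ncard ≤ r)
    (hH : ∀ q, 1 ≤ q → q ≤ r → Γ.CondH (S q) (i q) (j q) (B ^ (n - 3 - q)))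
    -- `e_1, …, e_r` are the edges of `T` listed in decreasing order of length
    (e : ℕ → Sym2 Γ.V)
    (he : ∀ q, 1 ≤ q → q ≤ r → e q ∈ Γ.G.edgeSet)
    (hdec : ∀ q q', 1 ≤ q → q < q' → q' ≤ r →
      e q ≠ e q' ∧ Γ.len (e q') < Γ.len (e q))
    -- `k_q < l_q` are minimizers of `(H_q)`
    (k l : ℕ → Fin n)
    (hmin : ∀ q, 1 ≤ q → q ≤ r →
      Γ.Minimizes (S q) (i q) (j q) (B ^ (n - 3 - q)) (k q) ∧
      Γ.Minimizes (S q) (i q) (j q) (B ^ (n - 3 - q)) (l q) ∧ k q < l q) :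
    CondStar n S i j Γ.toMTree r e k l := by
  have hn0 : (3 : ℝ) ≤ n := by exact_mod_cast hn
  have hB0 : 0 < B := by linarith
  have hproj (q : ℕ) (h1 : 1 ≤ q) (hr : q ≤ r) := MMTree.proj_sub_proj_of_minimizes
    (hmin q h1 hr).1 (hmin q h1 hr).2.1
  have hgap (q : ℕ) (h1 : 1 ≤ q) (hr : q ≤ r) : (1 : ℝ) ≤ ((l q : ℕ) : ℝ) - ((k q : ℕ) : ℝ) := by
    have h : (k q : ℕ) + 1 ≤ l q := (hmin q h1 hr).2.2
    have : ((k q : ℕ) : ℝ) + 1 ≤ ((l q : ℕ) : ℝ) := by exact_mod_cast h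
    linarith
  have hgap' (q : ℕ) : ((l q : ℕ) : ℝ) - ((k q : ℕ) : ℝ) ≤ n := by
    have h : ((l q : ℕ) : ℝ) ≤ n := by exact_mod_cast (l q).2.le
    have h' : (0 : ℝ) ≤ ((k q : ℕ) : ℝ) := Nat.cast_nonneg _
    linarith
  have hlt (q : ℕ) (h1 : 1 ≤ q) (hr : q ≤ r) :
      Γ.proj (i q) (j q) (l q) < Γ.proj (i q) (j q) (k q) := by
    have := mul_pos (lt_of_lt_of_le one_pos (hgap q h1 hr)) (pow_pos hB0 (n - 3 - q))
    linarith [hproj q h1 hr]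
  have hsum (q : ℕ) (h1 : 1 ≤ q) (hr : q ≤ r) :
      ∑ x ∈ Γ.commonEdges (i q) (j q) (k q) (l q), Γ.len x =
        (((l q : ℕ) : ℝ) - ((k q : ℕ) : ℝ)) * B ^ (n - 3 - q) := by
    rw [MMTree.sum_commonEdges hpos (hlt q h1 hr), hproj q h1 hr]
  have hcard : Γ.G.edgeFinset.card = Γ.G.edgeSet.ncard := by
    rw [← SimpleGraph.coe_edgeFinset, Set.ncard_coe_finset]
  have hanti : StrictAnti (Γ.len ∘ fun q : Finset.Icc 1 r => e q) := fun a b hab =>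
    (hdec a b (Finset.mem_Icc.1 a.2).1 hab (Finset.mem_Icc.1 b.2).2).2
  have heU (q : Finset.Icc 1 r) : e q ∈ Γ.G.edgeFinset :=
    SimpleGraph.mem_edgeFinset.2 (he q (Finset.mem_Icc.1 q.2).1 (Finset.mem_Icc.1 q.2).2)
  have hdom (q : Finset.Icc 1 r) :
      2 * ∑ q' with q < q',
        ∑ x ∈ Γ.commonEdges (i q') (j q') (k q') (l q'), Γ.len x <
      ∑ x ∈ Γ.commonEdges (i q) (j q) (k q) (l q), Γ.len x := by
    obtain ⟨hq1, hqr⟩ := Finset.mem_Icc.1 q.2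
    have h1 : ∑ q' with q < q', ∑ x ∈ Γ.commonEdges (i q') (j q') (k q') (l q'), Γ.len x ≤
        ∑ q' : Finset.Icc 1 r with q < q', n * B ^ (n - 3 - (q' : ℕ)) := by
      refine Finset.sum_le_sum fun q' _ => ?_
      rw [hsum q' (Finset.mem_Icc.1 q'.2).1 (Finset.mem_Icc.1 q'.2).2]
      exact mul_le_mul_of_nonneg_right (hgap' q') (pow_pos hB0 _).le
    have h2 : ∑ q' : Finset.Icc 1 r with q < q', n * B ^ (n - 3 - (q' : ℕ)) ≤
        ∑ p ∈ Finset.Ioc (q : ℕ) r, n * B ^ (n - 3 - p) := by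
      refine (Finset.sum_map (Finset.univ.filter (q < ·)) (Function.Embedding.subtype _)
        fun p => (n : ℝ) * B ^ (n - 3 - p)).symm.trans_le ?_
      refine Finset.sum_le_sum_of_subset_of_nonneg (fun p hp => ?_) fun p _ _ => by positivity
      obtain ⟨p', hp', rfl⟩ := Finset.mem_map.1 hp
      exact Finset.mem_Ioc.2 ⟨(Finset.mem_filter.1 hp').2, (Finset.mem_Icc.1 p'.2).2⟩
    have h3 := sum_Ioc_pow_sub_le hB hB0.le hqr hrn
    rw [← Finset.mul_sum (Finset.Ioc _ _)] at h2
    rw [hsum q hq1 hqr]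
    have h4 := mul_le_mul_of_nonneg_right (hgap q hq1 hqr) (pow_pos hB0 (n - 3 - q)).le
    have h5 := pow_pos hB0 (n - 3 - r)
    linarith
  have key := mem_and_notMem_of_dominating (by simpa [hcard] using hedge)
    (fun x hx => hpos x (SimpleGraph.mem_edgeFinset.1 hx))
    (fun q => Finset.filter_subset _ _) hdom heU hanti
  refine ⟨le_antisymm hedge ?_, he, fun q q' h1 h2 h3 => (hdec q q' h1 h2 h3).1,
    fun q h1 hr => ⟨(hmin q h1 hr).1.1, (hmin q h1 hr).2.1.1, (hmin q h1 hr).2.2,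
      fun w hw => MMTree.disjoint_of_proj_lt hpos (hlt q h1 hr) hw,
      Γ.mem_commonEdges.1 (key ⟨q, Finset.mem_Icc.2 ⟨h1, hr⟩⟩).1, fun q' h1' hq' hmem =>
      (key ⟨q', Finset.mem_Icc.2 ⟨h1', hq'.le.trans hr⟩⟩).2 ⟨q, Finset.mem_Icc.2 ⟨h1, hr⟩⟩ hq'
        (Γ.mem_commonEdges.2 hmem)⟩⟩
  rw [← hcard]
  simpa using Finset.card_le_card_of_injOn _ (fun q _ => heU q)
    (hanti.injective.of_comp.injOn (s := ((Finset.univ : Finset (Finset.Icc 1 r)) : Set _)))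

end TropPsi
end

section
/- Let r ≥ 1, let A be an admissible r×r real matrix, and let E ∈ ℝ^r be a vector all of whose entries lie in {0,1}. Then |(A^{−1}·E)_q| ≤ 2^(r−q) for every q ∈ {1,…,r}. (Paper: bound on the vector A_τ^{−1}E appearing in the block inversion of the path matrix of an edge-inserted tree, proof of the Lemma comparing the metrics of a tree and its contraction, Section 8.) -/
namespace TropPsi

/-- An `r × r` real matrix is *admissible* if it is upper triangular, every
diagonal entry equals `1`, and every entry strictly above the diagonal lies in
`{0, 1}`. -/
def Admissible {r : ℕ} (A : Matrix (Fin r) (Fin r) ℝ) : Prop :=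
  (∀ q q' : Fin r, q' < q → A q q' = 0) ∧
  (∀ q : Fin r, A q q = 1) ∧
  (∀ q q' : Fin r, q < q' → A q q' = 0 ∨ A q q' = 1)

theorem Admissible.det_eq_one {r : ℕ} {A : Matrix (Fin r) (Fin r) ℝ} (hA : Admissible A) :
    A.det = 1 := by
  have h : A.IsUpperTriangular := fun i j hij => hA.1 i j hij
  rw [Matrix.det_of_isUpperTriangular h]
  exact Finset.prod_eq_one fun i _ => hA.2.1 i

theorem Admissible.mulVec_apply {r : ℕ} {A : Matrix (Fin r) (Fin r) ℝ} (hA : Admissible A)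
    (x : Fin r → ℝ) (q : Fin r) :
    A.mulVec x q = x q + ∑ j ∈ Finset.Ioi q, A q j * x j := by
  have h : A.mulVec x q = ∑ j ∈ insert q (Finset.Ioi q), A q j * x j := by
    rw [Matrix.mulVec, dotProduct]
    refine (Finset.sum_subset (Finset.subset_univ _) fun j _ hj => ?_).symm
    have hjq : j < q := by
      simp only [Finset.mem_insert, Finset.mem_Ioi, not_or, not_lt] at hj
      exact lt_of_le_of_ne hj.2 hj.1
    rw [hA.1 q j hjq, zero_mul]
  rw [h, Finset.sum_insert (by simp), hA.2.1 q, one_mul]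

theorem sum_Ioi_two_pow {r : ℕ} (q : Fin r) :
    ∑ j ∈ Finset.Ioi q, (2 : ℝ) ^ (r - 1 - (j : ℕ)) = 2 ^ (r - 1 - (q : ℕ)) - 1 := by
  have h : ∑ j ∈ Finset.Ioi q, (2 : ℝ) ^ (r - 1 - (j : ℕ)) =
      ∑ k ∈ Finset.range (r - 1 - (q : ℕ)), (2 : ℝ) ^ k := by
    refine Finset.sum_bij' (fun j _ => r - 1 - (j : ℕ))
      (fun k _ => ⟨r - 1 - k, by have := q.isLt; omega⟩) ?_ ?_ ?_ ?_ ?_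
    · intro j hj
      have := j.isLt
      simp only [Finset.mem_Ioi, Fin.lt_def, Finset.mem_range] at hj ⊢
      omega
    · intro k hk
      simp only [Finset.mem_Ioi, Fin.lt_def, Finset.mem_range] at hk ⊢
      omega
    · intro j hj
      have := j.isLt
      ext
      dsimp only
      omega
    · intro k hk
      simp only [Finset.mem_range] at hk
      dsimp only
      omega
    · intro j hj
      rfl
  rw [h, geom_sum_eq (by norm_num)]
  norm_num

theorem Admissible.abs_le_two_pow {r : ℕ} {A : Matrix (Fin r) (Fin r) ℝ} (hA : Admissible A)
    {x : Fin r → ℝ} (hx : ∀ q, |A.mulVec x q| ≤ 1) (q : Fin r) :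
    |x q| ≤ 2 ^ (r - 1 - (q : ℕ)) := by
  induction q using WellFoundedGT.induction with
  | ind q ih =>
    have hsum : |∑ j ∈ Finset.Ioi q, A q j * x j| ≤ 2 ^ (r - 1 - (q : ℕ)) - 1 := by
      rw [← sum_Ioi_two_pow q]
      refine (Finset.abs_sum_le_sum_abs _ _).trans (Finset.sum_le_sum fun j hj => ?_)
      have hqj := Finset.mem_Ioi.mp hj
      rcases hA.2.2 q j hqj with h | h
      · rw [h, zero_mul, abs_zero]
        positivity
      · rw [h, one_mul]
        exact ih j hqj
    have hq := hx q
    rw [hA.mulVec_apply] at hq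
    rw [abs_le] at *
    constructor <;> linarith [hq.1, hq.2, hsum.1, hsum.2]

/-- bound on the vector `A⁻¹·E`, Section 8.  The paper's
index `q ∈ {1,…,r}` corresponds to `q : Fin r` with value `q + 1`, so the bound
`2^(r−q)` reads `2^(r − 1 − q.val)`. -/
theorem statement_15
    (r : ℕ) (hr : 1 ≤ r)
    (A : Matrix (Fin r) (Fin r) ℝ) (hA : Admissible A)
    (E : Fin r → ℝ) (hE : ∀ q, E q = 0 ∨ E q = 1) :
    ∀ q : Fin r, |A⁻¹.mulVec E q| ≤ (2 : ℝ) ^ (r - 1 - (q : ℕ)) := by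
  refine hA.abs_le_two_pow fun q => ?_
  rw [Matrix.mulVec_mulVec, Matrix.mul_nonsing_inv A (by simp [hA.det_eq_one]),
    Matrix.one_mulVec]
  rcases hE q with h | h <;> simp [h]

end TropPsi
end
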